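/- arXiv:2006.11100 — 3 statements merged into one kernel-verified Lean document; each statement's English description precedes it below -/
import Mathlib

section
/- Let 𝕍 be a persistence module of length n, let 1 ≤ b ≤ n, and let A_b be a subspace of V_b. Then dim A_b = Σ_{i = b}^{n} dim( f_{b,i}^𝕍(A_b) ∩ ker f_i^𝕍 ), where f_n^𝕍 : V_n → V_{n+1} = 0 is the zero map. -/
open Module Submodule LinearMap Finset

noncomputable section

/-- A persistence module of length `n` over a field `F`: finite-dimensional vector
spaces `V i` (indexed by `ℤ`, with the convention that `V i` is trivial for `i < 1`
or `i > n`) together with structure maps `f i : V i → V (i+1)`. -/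
structure PersMod (F : Type) [Field F] (n : ℕ) where
  V : ℤ → Type
  [acg : ∀ i, AddCommGroup (V i)]
  [mod : ∀ i, Module F (V i)]
  [fd : ∀ i, FiniteDimensional F (V i)]
  f : ∀ i : ℤ, V i →ₗ[F] V (i + 1)
  triv : ∀ i : ℤ, (i < 1 ∨ (n : ℤ) < i) → Subsingleton (V i)

attribute [instance] PersMod.acg PersMod.mod PersMod.fd

variable {F : Type} [Field F] {n : ℕ}

/-- Transport along an index equality. -/
def PersMod.castLM (M : PersMod F n) {i j : ℤ} (h : i = j) : M.V i →ₗ[F] M.V j := by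
  subst h; exact LinearMap.id

def PersMod.flAux (M : PersMod F n) (a : ℤ) : (k : ℕ) → (M.V a →ₗ[F] M.V (a + (k : ℤ)))
  | 0 => M.castLM (by simp)
  | (k + 1) => (M.castLM (by push_cast; ring)).comp ((M.f (a + (k : ℤ))).comp (M.flAux a k))

/-- The composite structure map `f_{a,b} : V a → V b` (the zero map if `b < a`);
`fl a a` is the identity. -/
def PersMod.fl (M : PersMod F n) (a b : ℤ) : M.V a →ₗ[F] M.V b :=
  if h : a ≤ b then (M.castLM (by omega)).comp (M.flAux a (b - a).toNat) else 0

/-- `S M a b = f_{a,b}(V a) ⊓ ker (f b)` when `1 ≤ a ≤ b ≤ n`, and `⊥` otherwise. -/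
def PersMod.S (M : PersMod F n) (a b : ℤ) : Submodule F (M.V b) :=
  if 1 ≤ a ∧ a ≤ b ∧ b ≤ (n : ℤ) then
    LinearMap.range (M.fl a b) ⊓ LinearMap.ker (M.f b)
  else ⊥

/-- The persistence diagram `D M a b = dim S_{a,b} - dim S_{a-1,b}` (as an integer). -/
def PersMod.D (M : PersMod F n) (a b : ℤ) : ℤ :=
  (Module.finrank F ↥(M.S a b) : ℤ) - (Module.finrank F ↥(M.S (a - 1) b) : ℤ)

/-- A morphism of persistence modules: linear maps commuting with structure maps. -/
structure PersHom (M N : PersMod F n) where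
  α : ∀ i : ℤ, M.V i →ₗ[F] N.V i
  comm : ∀ i : ℤ, (N.f i).comp (α i) = (α (i + 1)).comp (M.f i)

/-- `X^α(a,b,a',b')` from the paper. -/
def PersHom.X {M N : PersMod F n} (h : PersHom M N) (a b a' b' : ℤ) : ℤ :=
  if b' ≤ b ∧ b ≤ (n : ℤ) then
    (Module.finrank F
        ↥(M.S a b ⊓ Submodule.map (M.fl b' b) (Submodule.comap (h.α b') (N.S a' b'))) : ℤ)
      - (Module.finrank F
        ↥(M.S a b ⊓ Submodule.map (M.fl b' b) (LinearMap.ker (h.α b'))) : ℤ)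
  else 0

/-- The basis-independent partial matching `M^α` induced by `α`. -/
def PersHom.Mm {M N : PersMod F n} (h : PersHom M N) (a b a' b' : ℤ) : ℤ :=
  h.X a b a' b' - h.X (a - 1) b a' b' - h.X a b (a' - 1) b' + h.X (a - 1) b (a' - 1) b'

/-- The elder rule operator in the `i`-th variable. -/
def Efun {m : ℕ} (i : Fin m) (G : (Fin m → ℤ) → ℤ) : (Fin m → ℤ) → ℤ :=
  fun x => G x - G (Function.update x i (x i - 1))

/-- The restriction of a persistence module to a family of subspaces preserved
by the structure maps. -/
def PersMod.restrict (M : PersMod F n) (P : ∀ i : ℤ, Submodule F (M.V i))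
    (hP : ∀ i : ℤ, Submodule.map (M.f i) (P i) ≤ P (i + 1)) : PersMod F n where
  V i := ↥(P i)
  f i := (M.f i).restrict (fun x hx => hP i ⟨x, hx, rfl⟩)
  triv i hi := by
    have h := M.triv i hi
    exact ⟨fun a b => Subtype.ext (@Subsingleton.elim _ h _ _)⟩

/-- The restriction of a morphism of persistence modules to preserved families of
subspaces on source and target. -/
def PersHom.restrict {M N : PersMod F n} (h : PersHom M N)
    (P : ∀ i : ℤ, Submodule F (M.V i))
    (hP : ∀ i : ℤ, Submodule.map (M.f i) (P i) ≤ P (i + 1))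
    (Q : ∀ i : ℤ, Submodule F (N.V i))
    (hQ : ∀ i : ℤ, Submodule.map (N.f i) (Q i) ≤ Q (i + 1))
    (hα : ∀ i : ℤ, Submodule.map (h.α i) (P i) ≤ Q i) :
    PersHom (M.restrict P hP) (N.restrict Q hQ) where
  α i := (h.α i).restrict (fun x hx => hα i ⟨x, hx, rfl⟩)
  comm i := by
    ext x
    apply Subtype.ext
    show (N.f i) ((h.α i) x.1) = (h.α (i + 1)) ((M.f i) x.1)
    exact LinearMap.congr_fun (h.comm i) x.1

/-- The subspace `R(a,b,c,d)` (respectively `L(a',b',c,d)`, with `β` in place of `α`). -/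
def RL {V W : PersMod F n} (α : PersHom V W) (a b c d : ℤ) : Submodule F (W.V d) :=
  if a ≤ d ∧ c ≤ d ∧ d ≤ b then
    Submodule.map (α.α d) (LinearMap.range (V.fl a d) ⊓ LinearMap.ker (V.fl d (b + 1)))
      ⊓ W.S c d
  else ⊥

/-- `Y(a,b,a',b',c,d) = dim (R(a,b,c,d) ⊓ L(a',b',c,d))`. -/
def Yfun {V W U : PersMod F n} (α : PersHom V W) (β : PersHom U W)
    (a b a' b' c d : ℤ) : ℤ :=
  (Module.finrank F ↥(RL α a b c d ⊓ RL β a' b' c d) : ℤ)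

/-- `e_{c,d} = E_{1,2,3,4,5}(Y)(a,b,a',b',c,d)`. -/
def eG {V W U : PersMod F n} (α : PersHom V W) (β : PersHom U W)
    (a b a' b' c d : ℤ) : ℤ :=
  Efun (4 : Fin 6) (Efun 3 (Efun 2 (Efun 1 (Efun 0
    (fun x : Fin 6 → ℤ => Yfun α β (x 0) (x 1) (x 2) (x 3) (x 4) (x 5))))))
    ![a, b, a', b', c, d]

/-- The cardinality (with multiplicity) `#G^{α,β}(a,b,a',b')` of the enriched partial
matching: the sum of all positive `e_{c,d}` over `1 ≤ c ≤ d ≤ n`. -/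
def cardG {V W U : PersMod F n} (α : PersHom V W) (β : PersHom U W)
    (a b a' b' : ℤ) : ℤ :=
  ∑ d ∈ Finset.Icc (1 : ℤ) (n : ℤ), ∑ c ∈ Finset.Icc (1 : ℤ) d,
    if 0 < eG α β a b a' b' c d then eG α β a b a' b' c d else 0

theorem PersMod.castLM_castLM (M : PersMod F n) {i j k : ℤ} (h : i = j) (h' : j = k)
    (x : M.V i) : M.castLM h' (M.castLM h x) = M.castLM (h.trans h') x := by
  subst h; subst h'; rfl

theorem PersMod.castLM_self (M : PersMod F n) {i : ℤ} (h : i = i)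
    (x : M.V i) : M.castLM h x = x := rfl

theorem PersMod.f_castLM (M : PersMod F n) {i j : ℤ} (h : i = j) (h' : i + 1 = j + 1)
    (x : M.V i) : M.f j (M.castLM h x) = M.castLM h' (M.f i x) := by
  subst h; rfl

theorem PersMod.fl_eq (M : PersMod F n) (a b : ℤ) (k : ℕ) (h : a + (k : ℤ) = b) :
    M.fl a b = (M.castLM h).comp (M.flAux a k) := by
  obtain rfl : k = (b - a).toNat := by omega
  unfold PersMod.fl
  rw [dif_pos (by omega)]

theorem PersMod.fl_self (M : PersMod F n) (a : ℤ) : M.fl a a = LinearMap.id := by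
  rw [M.fl_eq a a 0 (by simp)]
  ext x
  simp [PersMod.flAux, PersMod.castLM_castLM, PersMod.castLM_self]

theorem PersMod.fl_succ (M : PersMod F n) (a b : ℤ) (hab : a ≤ b) :
    M.fl a (b + 1) = (M.f b).comp (M.fl a b) := by
  obtain ⟨k, rfl⟩ := Int.le.dest hab
  rw [M.fl_eq a (a + k) k rfl, M.fl_eq a (a + k + 1) (k + 1) (by push_cast; ring)]
  ext x
  simp [PersMod.flAux, PersMod.castLM_castLM, PersMod.castLM_self]

theorem PersMod.finrank_step (M : PersMod F n) (i : ℤ) (B : Submodule F (M.V i)) :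
    (Module.finrank F ↥B : ℤ) = (Module.finrank F ↥(B ⊓ LinearMap.ker (M.f i)) : ℤ)
      + (Module.finrank F ↥(Submodule.map (M.f i) B) : ℤ) := by
  have h := LinearMap.finrank_range_add_finrank_ker ((M.f i).domRestrict B)
  rw [LinearMap.range_domRestrict, LinearMap.ker_domRestrict] at h
  have e : Module.finrank F ↥(Submodule.comap B.subtype (LinearMap.ker (M.f i)))
      = Module.finrank F ↥(B ⊓ LinearMap.ker (M.f i)) := by
    rw [← Submodule.map_comap_subtype]
    exact (Submodule.equivMapOfInjective _ B.injective_subtype _).finrank_eq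
  rw [e] at h; omega

theorem PersMod.finrank_sum (M : PersMod F n) (b : ℤ) (A : Submodule F (M.V b)) (k : ℤ)
    (hk : b ≤ k) :
    (Module.finrank F ↥A : ℤ) =
      ∑ i ∈ Finset.Ico b k,
        (Module.finrank F ↥(Submodule.map (M.fl b i) A ⊓ LinearMap.ker (M.f i)) : ℤ)
      + (Module.finrank F ↥(Submodule.map (M.fl b k) A) : ℤ) := by
  induction k, hk using Int.le_induction with
  | base => rw [M.fl_self, Submodule.map_id]; simp
  | succ k hk ih =>
    have hI : Finset.Ico b (k + 1) = insert k (Finset.Ico b k) := by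
      ext x; simp only [Finset.mem_Ico, Finset.mem_insert]; omega
    rw [hI, Finset.sum_insert (by simp), M.fl_succ b k hk, Submodule.map_comp, ih,
      M.finrank_step k (Submodule.map (M.fl b k) A)]
    ring

/-- Lemma 7 of the paper: for a subspace `A ⊆ V b`,
`dim A = ∑_{i=b}^{n} dim (f_{b,i}(A) ⊓ ker f_i)`. -/
theorem stmt3 (M : PersMod F n) (b : ℤ) (hb : 1 ≤ b) (hbn : b ≤ (n : ℤ))
    (A : Submodule F (M.V b)) :
    (Module.finrank F ↥A : ℤ) =
      ∑ i ∈ Finset.Icc b (n : ℤ),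
        (Module.finrank F ↥(Submodule.map (M.fl b i) A ⊓ LinearMap.ker (M.f i)) : ℤ) := by
  have hI : Finset.Icc b (n : ℤ) = Finset.Ico b ((n : ℤ) + 1) := by
    ext x; simp only [Finset.mem_Ico, Finset.mem_Icc]; omega
  have := M.triv ((n : ℤ) + 1) (Or.inr (by omega))
  rw [hI, M.finrank_sum b A ((n : ℤ) + 1) (by omega),
    Module.finrank_zero_of_subsingleton (M := ↥(Submodule.map (M.fl b ((n : ℤ) + 1)) A))]
  simp
end
end

section
/- Let α : 𝕍 → 𝕌 be a morphism between persistence modules of length n that is the internal direct sum of two morphisms α¹ : 𝕍¹ → 𝕌¹ and α² : 𝕍² → 𝕌², i.e., V_i = V_i¹ ⊕ V_i² and U_i = U_i¹ ⊕ U_i² are internal direct sum decompositions preserved by the structure maps (f_i^𝕍(V_i^k) ⊆ V_{i+1}^k and f_i^𝕌(U_i^k) ⊆ U_{i+1}^k for k = 1, 2), and α_i(V_i^k) ⊆ U_i^k with α_i restricted to V_i^k equal to α_i^k. Then for all integers a, b, a', b': X^α(a, b, a', b') = X^{α¹}(a, b, a', b') + X^{α²}(a, b, a', b'). -/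
open Module Submodule LinearMap Finset

noncomputable section

variable {F : Type} [Field F] {n : ℕ}

/-- `W` corresponds to `W1 × W2` under the direct sum decomposition `e`. -/
def Dec {E E1 E2 : Type} [AddCommGroup E] [Module F E] [AddCommGroup E1] [Module F E1]
    [AddCommGroup E2] [Module F E2] (e : (E1 × E2) ≃ₗ[F] E)
    (W : Submodule F E) (W1 : Submodule F E1) (W2 : Submodule F E2) : Prop :=
  ∀ x1 x2, e (x1, x2) ∈ W ↔ x1 ∈ W1 ∧ x2 ∈ W2

section DecLemmas

variable {E E1 E2 : Type} [AddCommGroup E] [Module F E] [AddCommGroup E1] [Module F E1]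
    [AddCommGroup E2] [Module F E2] {e : (E1 × E2) ≃ₗ[F] E}
    {G G1 G2 : Type} [AddCommGroup G] [Module F G] [AddCommGroup G1] [Module F G1]
    [AddCommGroup G2] [Module F G2] {e' : (G1 × G2) ≃ₗ[F] G}

theorem Dec.inf {W W' : Submodule F E} {W1 W1' : Submodule F E1} {W2 W2' : Submodule F E2}
    (h : Dec e W W1 W2) (h' : Dec e W' W1' W2') : Dec e (W ⊓ W') (W1 ⊓ W1') (W2 ⊓ W2') := by
  intro x1 x2
  simp only [Submodule.mem_inf, h x1 x2, h' x1 x2]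
  tauto

theorem Dec.bot : Dec e (⊥ : Submodule F E) ⊥ ⊥ := by
  intro x1 x2
  simp

theorem Dec.comap {g : E →ₗ[F] G} {g1 : E1 →ₗ[F] G1} {g2 : E2 →ₗ[F] G2}
    (hg : ∀ x1 x2, g (e (x1, x2)) = e' (g1 x1, g2 x2))
    {W : Submodule F G} {W1 : Submodule F G1} {W2 : Submodule F G2} (h : Dec e' W W1 W2) :
    Dec e (W.comap g) (W1.comap g1) (W2.comap g2) := by
  intro x1 x2
  simp only [Submodule.mem_comap, hg, h _ _]

theorem Dec.map {g : E →ₗ[F] G} {g1 : E1 →ₗ[F] G1} {g2 : E2 →ₗ[F] G2}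
    (hg : ∀ x1 x2, g (e (x1, x2)) = e' (g1 x1, g2 x2))
    {W : Submodule F E} {W1 : Submodule F E1} {W2 : Submodule F E2} (h : Dec e W W1 W2) :
    Dec e' (W.map g) (W1.map g1) (W2.map g2) := by
  intro y1 y2
  simp only [Submodule.mem_map]
  constructor
  · rintro ⟨w, hw, hwy⟩
    obtain ⟨⟨x1, x2⟩, rfl⟩ := e.surjective w
    rw [hg] at hwy
    have := e'.injective hwy
    rw [Prod.mk.injEq] at this
    obtain ⟨h1, h2⟩ := (h x1 x2).1 hw
    exact ⟨⟨x1, h1, this.1⟩, ⟨x2, h2, this.2⟩⟩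
  · rintro ⟨⟨x1, h1, rfl⟩, ⟨x2, h2, rfl⟩⟩
    exact ⟨e (x1, x2), (h x1 x2).2 ⟨h1, h2⟩, hg x1 x2⟩

theorem Dec.ker {g : E →ₗ[F] G} {g1 : E1 →ₗ[F] G1} {g2 : E2 →ₗ[F] G2}
    (hg : ∀ x1 x2, g (e (x1, x2)) = e' (g1 x1, g2 x2)) :
    Dec e (LinearMap.ker g) (LinearMap.ker g1) (LinearMap.ker g2) :=
  Dec.comap hg Dec.bot

theorem Dec.range {g : E →ₗ[F] G} {g1 : E1 →ₗ[F] G1} {g2 : E2 →ₗ[F] G2}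
    (hg : ∀ x1 x2, g (e (x1, x2)) = e' (g1 x1, g2 x2)) :
    Dec e' (LinearMap.range g) (LinearMap.range g1) (LinearMap.range g2) := by
  rw [LinearMap.range_eq_map, LinearMap.range_eq_map, LinearMap.range_eq_map]
  exact Dec.map hg (fun _ _ => by simp)

theorem Dec.finrank [FiniteDimensional F E1] [FiniteDimensional F E2]
    {W : Submodule F E} {W1 : Submodule F E1} {W2 : Submodule F E2} (h : Dec e W W1 W2) :
    Module.finrank F W = Module.finrank F W1 + Module.finrank F W2 := by
  have h1 : W = (W1.prod W2).map (e : (E1 × E2) →ₗ[F] E) := by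
    ext w
    obtain ⟨⟨x1, x2⟩, rfl⟩ := e.surjective w
    rw [h x1 x2]
    simp
  rw [h1, ← Module.finrank_prod]
  let k : ↥(W1.prod W2) ≃ₗ[F] (↥W1 × ↥W2) :=
    { toFun := fun x => (⟨x.1.1, x.2.1⟩, ⟨x.1.2, x.2.2⟩)
      invFun := fun y => ⟨(y.1.1, y.2.1), ⟨y.1.2, y.2.2⟩⟩
      map_add' := fun _ _ => rfl
      map_smul' := fun _ _ => rfl
      left_inv := fun _ => rfl
      right_inv := fun _ => rfl }
  exact ((e.submoduleMap (W1.prod W2)).symm.trans k).finrank_eq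

end DecLemmas

section PersLemmas

variable {M M1 M2 : PersMod F n} {e : ∀ i, (M1.V i × M2.V i) ≃ₗ[F] M.V i}

theorem castLM_nat {i j : ℤ} (h : i = j) (x1 : M1.V i) (x2 : M2.V i) :
    M.castLM h (e i (x1, x2)) = e j (M1.castLM h x1, M2.castLM h x2) := by
  subst h
  rfl

theorem flAux_nat (hf : ∀ i x1 x2, M.f i (e i (x1, x2)) = e (i + 1) (M1.f i x1, M2.f i x2))
    (a : ℤ) (k : ℕ) (x1 : M1.V a) (x2 : M2.V a) :
    M.flAux a k (e a (x1, x2)) = e _ (M1.flAux a k x1, M2.flAux a k x2) := by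
  induction k with
  | zero => exact castLM_nat _ x1 x2
  | succ k ih =>
    simp only [PersMod.flAux, LinearMap.comp_apply]
    rw [ih, hf, castLM_nat]

theorem fl_nat (hf : ∀ i x1 x2, M.f i (e i (x1, x2)) = e (i + 1) (M1.f i x1, M2.f i x2))
    (a b : ℤ) (x1 : M1.V a) (x2 : M2.V a) :
    M.fl a b (e a (x1, x2)) = e b (M1.fl a b x1, M2.fl a b x2) := by
  unfold PersMod.fl
  split_ifs with h
  · simp only [LinearMap.comp_apply]
    rw [flAux_nat hf, castLM_nat]
  · exact (map_zero (e b)).symm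

theorem S_dec (hf : ∀ i x1 x2, M.f i (e i (x1, x2)) = e (i + 1) (M1.f i x1, M2.f i x2))
    (a b : ℤ) : Dec (e b) (M.S a b) (M1.S a b) (M2.S a b) := by
  unfold PersMod.S
  split_ifs with h
  · exact (Dec.range (fl_nat hf a b)).inf (Dec.ker (hf b))
  · exact Dec.bot

theorem X_add {N N1 N2 : PersMod F n} {e' : ∀ i, (N1.V i × N2.V i) ≃ₗ[F] N.V i}
    (hf : ∀ i x1 x2, M.f i (e i (x1, x2)) = e (i + 1) (M1.f i x1, M2.f i x2))
    (hf' : ∀ i x1 x2, N.f i (e' i (x1, x2)) = e' (i + 1) (N1.f i x1, N2.f i x2))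
    (h : PersHom M N) (h1 : PersHom M1 N1) (h2 : PersHom M2 N2)
    (hh : ∀ i x1 x2, h.α i (e i (x1, x2)) = e' i (h1.α i x1, h2.α i x2)) (a b a' b' : ℤ) :
    h.X a b a' b' = h1.X a b a' b' + h2.X a b a' b' := by
  unfold PersHom.X
  split_ifs with hb
  · rw [((S_dec hf a b).inf (Dec.map (fl_nat hf b' b)
      (Dec.comap (hh b') (S_dec hf' a' b')))).finrank,
      ((S_dec hf a b).inf (Dec.map (fl_nat hf b' b) (Dec.ker (hh b')))).finrank]
    push_cast
    ring
  · simp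

end PersLemmas

/-- Within the proof of Proposition 2 of the paper: if `α : 𝕍 → 𝕌` is the internal
direct sum of `α¹ : 𝕍¹ → 𝕌¹` and `α² : 𝕍² → 𝕌²`, then `X^α = X^{α¹} + X^{α²}`. -/
theorem stmt13 (Vm Um : PersMod F n) (h : PersHom Vm Um)
    (P1 P2 : ∀ i : ℤ, Submodule F (Vm.V i)) (Q1 Q2 : ∀ i : ℤ, Submodule F (Um.V i))
    (hPcompl : ∀ i : ℤ, IsCompl (P1 i) (P2 i)) (hQcompl : ∀ i : ℤ, IsCompl (Q1 i) (Q2 i))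
    (hP1 : ∀ i : ℤ, Submodule.map (Vm.f i) (P1 i) ≤ P1 (i + 1))
    (hP2 : ∀ i : ℤ, Submodule.map (Vm.f i) (P2 i) ≤ P2 (i + 1))
    (hQ1 : ∀ i : ℤ, Submodule.map (Um.f i) (Q1 i) ≤ Q1 (i + 1))
    (hQ2 : ∀ i : ℤ, Submodule.map (Um.f i) (Q2 i) ≤ Q2 (i + 1))
    (hα1 : ∀ i : ℤ, Submodule.map (h.α i) (P1 i) ≤ Q1 i)
    (hα2 : ∀ i : ℤ, Submodule.map (h.α i) (P2 i) ≤ Q2 i)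
    (a b a' b' : ℤ) :
    h.X a b a' b' =
      (h.restrict P1 hP1 Q1 hQ1 hα1).X a b a' b' +
        (h.restrict P2 hP2 Q2 hQ2 hα2).X a b a' b' := by
  refine X_add (e := fun i => Submodule.prodEquivOfIsCompl _ _ (hPcompl i))
    (e' := fun i => Submodule.prodEquivOfIsCompl _ _ (hQcompl i)) ?_ ?_ h _ _ ?_ a b a' b'
  · intro i x1 x2
    exact map_add (Vm.f i) x1.1 x2.1
  · intro i x1 x2
    exact map_add (Um.f i) x1.1 x2.1
  · intro i x1 x2
    exact map_add (h.α i) x1.1 x2.1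
end
end

section
/- Let 𝕍 →^α 𝕎 ←^β 𝕌 be a pair of morphisms between persistence modules of length n, and let 𝕂 be the persistence submodule of 𝕎 with K_i = α_i(V_i) ∩ β_i(U_i) and structure maps the restrictions of those of 𝕎. Then for every 1 ≤ d ≤ n: Σ_{c = 1}^{d} D^𝕂(c, d) = Σ_{b = d}^{n} Σ_{a = 1}^{d} Σ_{b' = d}^{n} Σ_{a' = 1}^{d} Σ_{c = 1}^{d} E_{1,2,3,4,5}(Y)(a, b, a', b', c, d). In other words, the number of intervals (counted with multiplicity) in the barcode of 𝕂 with right endpoint d equals the total multiplicity of intervals with right endpoint d appearing in the enriched partial matching G^{α,β}. -/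
open Module Submodule LinearMap Finset

noncomputable section

variable {F : Type} [Field F] {n : ℕ}

/-- The family `K i = α_i(V_i) ⊓ β_i(U_i)` is preserved by the structure maps of `W`. -/
theorem Kstep {V W U : PersMod F n} (α : PersHom V W) (β : PersHom U W) (i : ℤ) :
    Submodule.map (W.f i) (LinearMap.range (α.α i) ⊓ LinearMap.range (β.α i)) ≤
      LinearMap.range (α.α (i + 1)) ⊓ LinearMap.range (β.α (i + 1)) := by
  rintro x hx
  obtain ⟨y, ⟨⟨v, hv⟩, ⟨u, hu⟩⟩, rfl⟩ := hx
  refine ⟨⟨V.f i v, ?_⟩, ⟨U.f i u, ?_⟩⟩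
  · have h1 := LinearMap.congr_fun (α.comm i) v
    simp only [LinearMap.comp_apply] at h1
    rw [← h1, hv]
  · have h1 := LinearMap.congr_fun (β.comm i) u
    simp only [LinearMap.comp_apply] at h1
    rw [← h1, hu]

/-- The persistence submodule `𝕂` of `𝕎` with `K i = α_i(V_i) ⊓ β_i(U_i)` and structure
maps the restrictions of those of `𝕎`. -/
def Kmod {V W U : PersMod F n} (α : PersHom V W) (β : PersHom U W) : PersMod F n :=
  W.restrict (fun i => LinearMap.range (α.α i) ⊓ LinearMap.range (β.α i))
    (fun i => Kstep α β i)

theorem castLM_surj (M : PersMod F n) {i j : ℤ} (h : i = j) :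
    Function.Surjective (M.castLM h) := by
  subst h
  exact fun x => ⟨x, rfl⟩

theorem flAux_surj (M : PersMod F n) (a : ℤ) (k : ℕ) (hk : k = 0) :
    Function.Surjective (M.flAux a k) := by
  subst hk
  exact castLM_surj M _

theorem fl_self_range (M : PersMod F n) (a : ℤ) : LinearMap.range (M.fl a a) = ⊤ := by
  rw [LinearMap.range_eq_top, PersMod.fl, dif_pos le_rfl, LinearMap.coe_comp]
  exact (castLM_surj M _).comp (flAux_surj M a _ (by simp))

theorem sum_tele (g : ℤ → ℤ) (p q : ℤ) (h : p ≤ q + 1) :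
    ∑ x ∈ Finset.Icc p q, (g x - g (x - 1)) = g q - g (p - 1) := by
  obtain ⟨k, hk⟩ := Int.eq_ofNat_of_zero_le (show 0 ≤ q + 1 - p by omega)
  induction k generalizing q with
  | zero =>
    have : q = p - 1 := by simp at hk; omega
    subst this
    simp
  | succ k ih =>
    have h1 := ih (q - 1) (by push_cast at hk; omega) (by push_cast at hk ⊢; omega)
    have h2 : Finset.Icc p q = insert q (Finset.Icc p (q - 1)) := by
      ext x
      simp only [Finset.mem_Icc, Finset.mem_insert]
      push_cast at hk
      omega
    rw [h2, Finset.sum_insert (by simp), h1]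
    ring

theorem S_zero (M : PersMod F n) (d : ℤ) : M.S 0 d = ⊥ := by
  simp [PersMod.S]

theorem RL_c0 {V W : PersMod F n} (α : PersHom V W) (a b d : ℤ) : RL α a b 0 d = ⊥ := by
  simp [RL, S_zero]

theorem RL_b {V W : PersMod F n} (α : PersHom V W) (a c d : ℤ) : RL α a (d - 1) c d = ⊥ := by
  rw [RL, if_neg (by omega)]

theorem RL_a0 {V W : PersMod F n} (α : PersHom V W) (b c d : ℤ) : RL α 0 b c d = ⊥ := by
  have h : LinearMap.range (V.fl 0 d) = ⊥ := by
    have := V.triv 0 (by omega)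
    rw [LinearMap.range_eq_bot]
    ext x
    rw [Subsingleton.elim x 0]
    simp
  simp [RL, h]

theorem RL_top {V W : PersMod F n} (α : PersHom V W) (d : ℤ) (hd1 : 1 ≤ d) (hdn : d ≤ (n : ℤ)) :
    RL α d n d d = LinearMap.range (α.α d) ⊓ LinearMap.ker (W.f d) := by
  have h : LinearMap.ker (V.fl d ((n : ℤ) + 1)) = ⊤ := by
    have := V.triv ((n : ℤ) + 1) (by omega)
    rw [LinearMap.ker_eq_top]
    ext x
    exact Subsingleton.elim _ _
  rw [RL, if_pos (by omega), PersMod.S, if_pos (by omega), h, fl_self_range, fl_self_range]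
  simp

/-- One-variable difference. -/
def dl (g : ℤ → ℤ) (x : ℤ) : ℤ := g x - g (x - 1)

theorem sum_dl (g : ℤ → ℤ) (p q : ℤ) (h : p ≤ q + 1) (h0 : g (p - 1) = 0) :
    ∑ x ∈ Finset.Icc p q, dl g x = g q := by
  simp only [dl]
  rw [sum_tele g p q h, h0, sub_zero]

theorem dl_zero (x : ℤ) : dl (fun _ => 0) x = 0 := by simp [dl]

theorem eG_eq {V W U : PersMod F n} (α : PersHom V W) (β : PersHom U W)
    (a b a' b' c d : ℤ) : eG α β a b a' b' c d =
    dl (fun c => dl (fun b' => dl (fun a' => dl (fun b => dl (fun a =>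
      Yfun α β a b a' b' c d) a) b) a') b') c := by
  rfl

theorem sum_dl_swap (s : Finset ℤ) (g : ℤ → ℤ → ℤ) (x : ℤ) :
    ∑ y ∈ s, dl (fun x => g x y) x = dl (fun x => ∑ y ∈ s, g x y) x := by
  simp [dl, Finset.sum_sub_distrib]

theorem K_finrank {V W U : PersMod F n} (α : PersHom V W) (β : PersHom U W)
    (d : ℤ) (hd1 : 1 ≤ d) (hdn : d ≤ (n : ℤ)) :
    Module.finrank F ((Kmod α β).S d d) =
      Module.finrank F ↥(RL α d n d d ⊓ RL β d n d d) := by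
  rw [RL_top α d hd1 hdn, RL_top β d hd1 hdn, PersMod.S, if_pos (by omega), fl_self_range,
    top_inf_eq]
  let P : Submodule F (W.V d) := LinearMap.range (α.α d) ⊓ LinearMap.range (β.α d)
  let k : Submodule F P := LinearMap.ker ((Kmod α β).f d)
  have hk : k = Submodule.comap P.subtype (LinearMap.ker (W.f d)) := by
    ext x
    exact Subtype.ext_iff
  have e : Submodule.map P.subtype k = LinearMap.range (α.α d) ⊓ LinearMap.ker (W.f d) ⊓
      (LinearMap.range (β.α d) ⊓ LinearMap.ker (W.f d)) := by
    rw [hk, Submodule.map_comap_subtype, ← inf_inf_distrib_right]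
  rw [← e]
  exact (Submodule.equivMapOfInjective P.subtype P.injective_subtype k).finrank_eq

/-- Theorem 4 of the paper: the number of intervals in the barcode of `𝕂` with right
endpoint `d` equals the total multiplicity of intervals with right endpoint `d` in the
enriched partial matching `G^{α,β}`. -/
theorem stmt18 (V W U : PersMod F n) (α : PersHom V W) (β : PersHom U W)
    (d : ℤ) (hd1 : 1 ≤ d) (hdn : d ≤ (n : ℤ)) :
    ∑ c ∈ Finset.Icc (1 : ℤ) d, (Kmod α β).D c d =
      ∑ b ∈ Finset.Icc d (n : ℤ), ∑ a ∈ Finset.Icc (1 : ℤ) d,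
        ∑ b' ∈ Finset.Icc d (n : ℤ), ∑ a' ∈ Finset.Icc (1 : ℤ) d,
          ∑ c ∈ Finset.Icc (1 : ℤ) d, eG α β a b a' b' c d := by
  have hL : ∑ c ∈ Finset.Icc (1 : ℤ) d, (Kmod α β).D c d =
      (Module.finrank F ((Kmod α β).S d d) : ℤ) :=
    sum_dl (fun c => (Module.finrank F ((Kmod α β).S c d) : ℤ)) 1 d (by omega)
      (by simp [S_zero])
  have hY : ∀ a b a' b' c, (a = 0 ∨ a' = 0 ∨ b = d - 1 ∨ b' = d - 1 ∨ c = 0) →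
      Yfun α β a b a' b' c d = 0 := by
    rintro a b a' b' c (rfl | rfl | rfl | rfl | rfl) <;>
      simp [Yfun, RL_a0, RL_b, RL_c0]
  rw [hL, K_finrank α β d hd1 hdn]
  simp only [eG_eq]
  have h1 : ∀ a b a' b', ∑ c ∈ Finset.Icc (1 : ℤ) d,
      dl (fun c => dl (fun b' => dl (fun a' => dl (fun b => dl (fun a =>
        Yfun α β a b a' b' c d) a) b) a') b') c =
      dl (fun b' => dl (fun a' => dl (fun b => dl (fun a =>
        Yfun α β a b a' b' d d) a) b) a') b' := by
    intro a b a' b'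
    rw [sum_dl _ 1 d (by omega)]
    simp [hY, dl]
  simp only [h1]
  have h2 : ∀ a b b', ∑ a' ∈ Finset.Icc (1 : ℤ) d,
      dl (fun b' => dl (fun a' => dl (fun b => dl (fun a =>
        Yfun α β a b a' b' d d) a) b) a') b' =
      dl (fun b' => dl (fun b => dl (fun a => Yfun α β a b d b' d d) a) b) b' := by
    intro a b b'
    rw [sum_dl_swap _ (fun b' a' => dl (fun a' => dl (fun b => dl (fun a =>
        Yfun α β a b a' b' d d) a) b) a')]
    congr 1
    funext b'
    rw [sum_dl _ 1 d (by omega)]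
    simp [hY, dl]
  simp only [h2]
  have h3 : ∀ a b, ∑ b' ∈ Finset.Icc d (n : ℤ),
      dl (fun b' => dl (fun b => dl (fun a => Yfun α β a b d b' d d) a) b) b' =
      dl (fun b => dl (fun a => Yfun α β a b d n d d) a) b := by
    intro a b
    rw [sum_dl _ d n (by omega)]
    simp [hY, dl]
  simp only [h3]
  have h4 : ∀ b, ∑ a ∈ Finset.Icc (1 : ℤ) d,
      dl (fun b => dl (fun a => Yfun α β a b d n d d) a) b =
      dl (fun b => Yfun α β d b d n d d) b := by
    intro b
    rw [sum_dl_swap _ (fun b a => dl (fun a => Yfun α β a b d n d d) a)]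
    congr 1
    funext b
    rw [sum_dl _ 1 d (by omega)]
    simp [hY]
  simp only [h4]
  rw [sum_dl _ d n (by omega) (by simp [hY])]
  rfl
end
end
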